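/- Fix ε > 0 and α ∈ [0,1]. Let (χ_n) ⊂ IP(μ) be a sequence of admissible irrigation plans, all parameterized by arc-length, whose stopping times satisfy ∫_Θ T_n(θ) dθ ≤ C for some constant C > 0 and all n ≥ 1. Assume there exists χ ∈ IP(μ) such that χ_n → χ. Then liminf_{n→∞} E^α_ε(χ_n) ≥ E^α_ε(χ). -/

import Mathlib

open MeasureTheory Filter Topology
open scoped ENNReal NNReal

noncomputable section

/-- Euclidean space `ℝ^d`. -/
abbrev Euc (d : ℕ) : Type := EuclideanSpace ℝ (Fin d)

/-- `Θ = [0, M]` where `M = μ(ℝ^d)` is the total mass. -/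
def Theta {d : ℕ} (μ : Measure (Euc d)) : Set ℝ := Set.Icc 0 (μ Set.univ).toReal

/-- The stopping time `T(θ)` of a Lagrangian path. -/
def stopTime {d : ℕ} (χ : ℝ → ℝ → Euc d) (θ : ℝ) : ℝ :=
  sInf {t : ℝ | 0 < t ∧ ∀ t' ≥ t, χ θ t' = χ θ t}

/-- An admissible irrigation plan for the measure `μ`: measurable, `1`-Lipschitz and eventually
constant paths, all starting at the origin, whose final positions push the Lebesgue measure
on `Θ = [0,M]` forward onto `μ`. -/
structure IsIrrigPlan {d : ℕ} (μ : Measure (Euc d)) (χ : ℝ → ℝ → Euc d) : Prop where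
  measurable : Measurable (Function.uncurry χ)
  lipschitz : ∀ θ ∈ Theta μ, LipschitzWith 1 (χ θ)
  eventuallyConst : ∀ θ ∈ Theta μ, ∃ t, 0 < t ∧ ∀ t' ≥ t, χ θ t' = χ θ t
  init : ∀ θ ∈ Theta μ, χ θ 0 = 0
  pushforward :
    Measure.map (fun θ => χ θ (stopTime χ θ)) (volume.restrict (Theta μ)) = μ

/-- The multiplicity `|x|_χ`: the measure of the set of particles passing through `x`. -/
def mult {d : ℕ} (μ : Measure (Euc d)) (χ : ℝ → ℝ → Euc d) (x : Euc d) : ℝ≥0∞ :=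
  volume {θ ∈ Theta μ | ∃ t, 0 ≤ t ∧ χ θ t = x}

/-- The `α`-irrigation cost `E^α(χ)`. -/
def irrCost {d : ℕ} (μ : Measure (Euc d)) (α : ℝ) (χ : ℝ → ℝ → Euc d) : ℝ≥0∞ :=
  ∫⁻ θ in Theta μ, ∫⁻ t in Set.Ici (0:ℝ),
    (mult μ χ (χ θ t)) ^ (α - 1) * (‖deriv (χ θ) t‖₊ : ℝ≥0∞)

/-- `ρ(θ,x) = min_{t ≥ 0} |χ(θ,t) − x|`. -/
def pathInfDist {d : ℕ} (χ : ℝ → ℝ → Euc d) (θ : ℝ) (x : Euc d) : ℝ :=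
  ⨅ t : Set.Ici (0:ℝ), dist (χ θ (t : ℝ)) x

/-- A mollifying kernel: a nonnegative, non-increasing, Lipschitz function on `ℝ₊`
with `J(0) = 1` and `J(r) → 0` as `r → ∞`. -/
def MollKernel (J : ℝ → ℝ) : Prop :=
  (∀ r, 0 ≤ r → 0 ≤ J r) ∧ AntitoneOn J (Set.Ici 0) ∧
    (∃ K : ℝ≥0, LipschitzOnWith K J (Set.Ici 0)) ∧ J 0 = 1 ∧ Tendsto J atTop (𝓝 0)

/-- The mollified multiplicity `W_ε(x,χ) = ∫_Θ J_ε(min_{t≥0} |χ(θ,t) − x|) dθ`. -/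
def Wmol {d : ℕ} (μ : Measure (Euc d)) (J : ℝ → ℝ) (ε : ℝ) (χ : ℝ → ℝ → Euc d)
    (x : Euc d) : ℝ≥0∞ :=
  ∫⁻ θ in Theta μ, ENNReal.ofReal (J (pathInfDist χ θ x / ε))

/-- The mollified irrigation cost `E^α_ε(χ)`. -/
def Emol {d : ℕ} (μ : Measure (Euc d)) (J : ℝ → ℝ) (α ε : ℝ)
    (χ : ℝ → ℝ → Euc d) : ℝ≥0∞ :=
  ∫⁻ θ in Theta μ, ∫⁻ t in Set.Ici (0:ℝ),
    (Wmol μ J ε χ (χ θ t)) ^ (α - 1) * (‖deriv (χ θ) t‖₊ : ℝ≥0∞)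

/-- The distance `d(γ₀,γ₁) = sup_{k ≥ 1} (1/k) ‖γ₀ − γ₁‖_{L^∞([0,k])}` between paths. -/
def dPath {d : ℕ} (γ₀ γ₁ : ℝ → Euc d) : ℝ :=
  ⨆ k : ℕ+, (1 / ((k : ℕ) : ℝ)) *
    ⨆ t : Set.Icc (0:ℝ) ((k : ℕ) : ℝ), dist (γ₀ (t : ℝ)) (γ₁ (t : ℝ))

/-- Convergence `χ_n → χ` of irrigation plans: `d(χ_n(θ,·), χ(θ,·)) → 0` for a.e. `θ ∈ Θ`. -/
def PlansTendsto {d : ℕ} (μ : Measure (Euc d)) (χs : ℕ → ℝ → ℝ → Euc d)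
    (χ : ℝ → ℝ → Euc d) : Prop :=
  ∀ᵐ θ ∂(volume.restrict (Theta μ)),
    Tendsto (fun n => dPath (χs n θ) (χ θ)) atTop (𝓝 0)

/-- The plan `χ` is parameterized by arc-length: for a.e. `t`, `|∂_t χ(θ,t)| = 1` for
`0 < t < T(θ)` and `|∂_t χ(θ,t)| = 0` for `t > T(θ)`. -/
def ArcLength {d : ℕ} (μ : Measure (Euc d)) (χ : ℝ → ℝ → Euc d) : Prop :=
  ∀ θ ∈ Theta μ, ∀ᵐ t ∂(volume : Measure ℝ),
    (0 < t → t < stopTime χ θ → ‖deriv (χ θ) t‖ = 1) ∧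
    (stopTime χ θ < t → ‖deriv (χ θ) t‖ = 0)

/-- An alternative mollifying kernel: smooth, positive, strictly decreasing on `ℝ₊`,
with `1 ≤ ∫₀^∞ J(r) dr < ∞`. -/
def MollKernel2 (J : ℝ → ℝ) : Prop :=
  ContDiffOn ℝ (⊤ : ℕ∞) J (Set.Ici 0) ∧ (∀ r, 0 ≤ r → 0 < J r) ∧ StrictAntiOn J (Set.Ici 0) ∧
    IntegrableOn J (Set.Ioi 0) volume ∧ 1 ≤ ∫ r in Set.Ioi (0:ℝ), J r

/-- The alternative mollified multiplicity
`W̃_ε(x,χ) = ∫_Θ min{1, ∫₀^∞ (1/ε) J_ε(|χ(θ,t) − x|) |∂_t χ(θ,t)| dt} dθ`. -/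
def Wtil {d : ℕ} (μ : Measure (Euc d)) (J : ℝ → ℝ) (ε : ℝ) (χ : ℝ → ℝ → Euc d)
    (x : Euc d) : ℝ≥0∞ :=
  ∫⁻ θ in Theta μ,
    min 1 (∫⁻ t in Set.Ici (0:ℝ),
      ENNReal.ofReal ((1 / ε) * J (dist (χ θ t) x / ε)) * (‖deriv (χ θ) t‖₊ : ℝ≥0∞))

/-- The alternative mollified irrigation cost `Ẽ^α_ε(χ)`. -/
def Etil {d : ℕ} (μ : Measure (Euc d)) (J : ℝ → ℝ) (α ε : ℝ)
    (χ : ℝ → ℝ → Euc d) : ℝ≥0∞ :=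
  ∫⁻ θ in Theta μ, ∫⁻ t in Set.Ici (0:ℝ),
    (Wtil μ J ε χ (χ θ t)) ^ (α - 1) * (‖deriv (χ θ) t‖₊ : ℝ≥0∞)

section MollifiedCost

lemma exists_nnrat_btwn {a b : ℝ} (ha : 0 ≤ a) (hab : a < b) :
    ∃ q : ℚ≥0, a < (q : ℝ) ∧ (q : ℝ) < b := by
  obtain ⟨q, hq₁, hq₂⟩ := exists_rat_btwn hab
  have hq : (0 : ℚ) ≤ q := by exact_mod_cast ha.trans hq₁.le
  lift q to ℚ≥0 using hq
  exact ⟨q, by simpa using hq₁, by simpa using hq₂⟩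

variable {d : ℕ}

lemma bddBelow_dist_range (γ : ℝ → Euc d) (x : Euc d) {ι : Type*} (f : ι → ℝ) :
    BddBelow (Set.range fun i => dist (γ (f i)) x) :=
  ⟨0, by rintro _ ⟨i, rfl⟩; exact dist_nonneg⟩

lemma pathInfDist_nonneg (χ : ℝ → ℝ → Euc d) (θ : ℝ) (x : Euc d) : 0 ≤ pathInfDist χ θ x :=
  Real.iInf_nonneg fun _ => dist_nonneg

lemma pathInfDist_le (χ : ℝ → ℝ → Euc d) (θ : ℝ) (x : Euc d) {t : ℝ} (ht : 0 ≤ t) :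
    pathInfDist χ θ x ≤ dist (χ θ t) x :=
  ciInf_le (bddBelow_dist_range (χ θ) x fun t : Set.Ici (0 : ℝ) => (t : ℝ)) ⟨t, ht⟩

lemma le_pathInfDist {χ : ℝ → ℝ → Euc d} {θ : ℝ} {x : Euc d} {c : ℝ}
    (h : ∀ t, 0 ≤ t → c ≤ dist (χ θ t) x) : c ≤ pathInfDist χ θ x :=
  haveI : Nonempty (Set.Ici (0 : ℝ)) := ⟨⟨0, Set.self_mem_Ici⟩⟩
  le_ciInf fun t => h t t.2

/-- The infimum distance to a Lipschitz path may be computed at rational times. -/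
lemma pathInfDist_eq_iInf_nnrat {χ : ℝ → ℝ → Euc d} {θ : ℝ} (h : LipschitzWith 1 (χ θ))
    (x : Euc d) : pathInfDist χ θ x = ⨅ q : ℚ≥0, dist (χ θ (q : ℝ)) x := by
  refine le_antisymm (le_ciInf fun q => pathInfDist_le χ θ x q.cast_nonneg)
    (le_pathInfDist fun t ht => le_of_forall_pos_le_add fun δ hδ => ?_)
  obtain ⟨q, hq₁, hq₂⟩ := exists_nnrat_btwn ht (lt_add_of_pos_right t hδ)
  have h₁ := ciInf_le (bddBelow_dist_range (χ θ) x fun q : ℚ≥0 => (q : ℝ)) q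
  have h₂ := h.dist_le_mul (q : ℝ) t
  have h₃ := dist_triangle (χ θ q) (χ θ t) x
  rw [Real.dist_eq, abs_of_pos (sub_pos.2 hq₁)] at h₂
  simp only [NNReal.coe_one, one_mul] at h₂
  linarith

/-- The distance `dPath` controls the uniform distance on bounded time intervals. -/
lemma dist_le_mul_dPath {γ₀ γ₁ : ℝ → Euc d} (h₀ : LipschitzWith 1 γ₀) (h₁ : LipschitzWith 1 γ₁)
    (h : γ₀ 0 = γ₁ 0) (k : ℕ+) {t : ℝ} (ht : t ∈ Set.Icc (0 : ℝ) ((k : ℕ) : ℝ)) :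
    dist (γ₀ t) (γ₁ t) ≤ ((k : ℕ) : ℝ) * dPath γ₀ γ₁ := by
  have key : ∀ (k : ℕ+) (t : Set.Icc (0 : ℝ) ((k : ℕ) : ℝ)),
      dist (γ₀ t) (γ₁ t) ≤ ((k : ℕ) : ℝ) * 2 := by
    intro k t
    have a := h₀.dist_le_mul (t : ℝ) 0
    have b := h₁.dist_le_mul (t : ℝ) 0
    have c := dist_triangle_right (γ₀ t) (γ₁ t) (γ₀ 0)
    have e := t.2.2
    rw [Real.dist_eq, sub_zero, abs_of_nonneg t.2.1] at a b
    simp only [NNReal.coe_one, one_mul] at a b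
    rw [h] at c a
    linarith
  have hk : (0 : ℝ) < ((k : ℕ) : ℝ) := by exact_mod_cast k.pos
  have hsup : dist (γ₀ t) (γ₁ t) ≤
      ⨆ t : Set.Icc (0 : ℝ) ((k : ℕ) : ℝ), dist (γ₀ (t : ℝ)) (γ₁ (t : ℝ)) :=
    le_ciSup (f := fun t : Set.Icc (0 : ℝ) ((k : ℕ) : ℝ) => dist (γ₀ (t : ℝ)) (γ₁ (t : ℝ)))
      ⟨((k : ℕ) : ℝ) * 2, by rintro _ ⟨t, rfl⟩; exact key k t⟩ ⟨t, ht⟩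
  have hd : (1 / ((k : ℕ) : ℝ)) *
      (⨆ t : Set.Icc (0 : ℝ) ((k : ℕ) : ℝ), dist (γ₀ (t : ℝ)) (γ₁ (t : ℝ))) ≤ dPath γ₀ γ₁ := by
    refine le_ciSup (f := fun k : ℕ+ => (1 / ((k : ℕ) : ℝ)) *
      ⨆ t : Set.Icc (0 : ℝ) ((k : ℕ) : ℝ), dist (γ₀ (t : ℝ)) (γ₁ (t : ℝ))) ⟨2, ?_⟩ k
    rintro _ ⟨m, rfl⟩
    have hm : (0 : ℝ) < ((m : ℕ) : ℝ) := by exact_mod_cast m.pos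
    have : (⨆ t : Set.Icc (0 : ℝ) ((m : ℕ) : ℝ), dist (γ₀ (t : ℝ)) (γ₁ (t : ℝ))) ≤
        ((m : ℕ) : ℝ) * 2 := Real.iSup_le (key m) (by positivity)
    dsimp only
    rwa [one_div, inv_mul_le_iff₀ hm]
  calc dist (γ₀ t) (γ₁ t) ≤ _ := hsup
    _ = ((k : ℕ) : ℝ) * ((1 / ((k : ℕ) : ℝ)) *
        ⨆ t : Set.Icc (0 : ℝ) ((k : ℕ) : ℝ), dist (γ₀ (t : ℝ)) (γ₁ (t : ℝ))) := by field_simp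
    _ ≤ _ := by gcongr

/-- Convergence for `dPath` is uniform on bounded time intervals. -/
lemma eventually_dist_lt_of_tendsto_dPath {γs : ℕ → ℝ → Euc d} {γ : ℝ → Euc d}
    (hs : ∀ n, LipschitzWith 1 (γs n)) (h : LipschitzWith 1 γ) (h₀ : ∀ n, γs n 0 = γ 0)
    (hlim : Tendsto (fun n => dPath (γs n) γ) atTop (𝓝 0)) (A : ℝ) {η : ℝ} (hη : 0 < η) :
    ∀ᶠ n in atTop, ∀ t ∈ Set.Icc 0 A, dist (γs n t) (γ t) < η := by
  obtain ⟨m, hm⟩ := exists_nat_ge A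
  let k : ℕ+ := ⟨m + 1, m.succ_pos⟩
  have hk : A ≤ ((k : ℕ) : ℝ) := hm.trans (by simp [k])
  have := hlim.const_mul ((k : ℕ) : ℝ)
  rw [mul_zero] at this
  filter_upwards [this.eventually_lt_const hη] with n hn t ht
  exact (dist_le_mul_dPath (hs n) h (h₀ n) k ⟨ht.1, ht.2.trans hk⟩).trans_lt hn

lemma tendsto_of_tendsto_dPath {γs : ℕ → ℝ → Euc d} {γ : ℝ → Euc d}
    (hs : ∀ n, LipschitzWith 1 (γs n)) (h : LipschitzWith 1 γ) (h₀ : ∀ n, γs n 0 = γ 0)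
    (hlim : Tendsto (fun n => dPath (γs n) γ) atTop (𝓝 0)) {t : ℝ} (ht : 0 ≤ t) :
    Tendsto (fun n => γs n t) atTop (𝓝 (γ t)) := by
  rw [Metric.tendsto_nhds]
  intro η hη
  filter_upwards [eventually_dist_lt_of_tendsto_dPath hs h h₀ hlim t hη] with n hn
  exact hn t ⟨ht, le_rfl⟩

/-- The path `χ(θ,·)` is not constant after time `t`. -/
def MovesAfter (χ : ℝ → ℝ → Euc d) (θ t : ℝ) : Prop :=
  ∃ q : ℚ≥0, χ θ (t + q) ≠ χ θ t

lemma not_movesAfter_iff {χ : ℝ → ℝ → Euc d} {θ t : ℝ} (h : Continuous (χ θ)) :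
    ¬ MovesAfter χ θ t ↔ ∀ s ≥ t, χ θ s = χ θ t := by
  refine ⟨fun hm s hs => ?_, fun hc ⟨q, hq⟩ => hq (hc _ (by simp [q.cast_nonneg]))⟩
  simp only [MovesAfter, not_exists, not_not] at hm
  by_contra hne
  have hopen : IsOpen {r | χ θ (t + r) ≠ χ θ t} :=
    isOpen_ne_fun (h.comp (continuous_const.add continuous_id)) continuous_const
  have hmem : s - t ∈ {r | χ θ (t + r) ≠ χ θ t} := by simpa using hne
  obtain ⟨δ, hδ, hball⟩ := Metric.isOpen_iff.1 hopen _ hmem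
  obtain ⟨q, hq₁, hq₂⟩ := exists_nnrat_btwn (sub_nonneg.2 hs) (lt_add_of_pos_right (s - t) hδ)
  refine hball (?_ : (q : ℝ) ∈ Metric.ball (s - t) δ) (hm q)
  rw [Metric.mem_ball, Real.dist_eq, abs_lt]
  constructor <;> linarith

lemma stopTime_le {χ : ℝ → ℝ → Euc d} {θ t : ℝ} (ht : 0 < t) (h : ∀ s ≥ t, χ θ s = χ θ t) :
    stopTime χ θ ≤ t :=
  csInf_le ⟨0, fun _ hs => hs.1.le⟩ ⟨ht, h⟩

lemma eq_of_stopTime_lt {χ : ℝ → ℝ → Euc d} {θ t : ℝ}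
    (he : ∃ t, 0 < t ∧ ∀ t' ≥ t, χ θ t' = χ θ t) (h : stopTime χ θ < t) :
    ∀ s ≥ t, χ θ s = χ θ t := by
  obtain ⟨u, hu, hut⟩ := exists_lt_of_csInf_lt he h
  intro s hs
  rw [hu.2 s (hut.le.trans hs), hu.2 t hut.le]

lemma eq_stopTime {χ : ℝ → ℝ → Euc d} {θ : ℝ} (hc : Continuous (χ θ))
    (he : ∃ t, 0 < t ∧ ∀ t' ≥ t, χ θ t' = χ θ t) :
    ∀ s ≥ stopTime χ θ, χ θ s = χ θ (stopTime χ θ) := by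
  intro s hs
  rcases hs.eq_or_lt with rfl | hs
  · rfl
  have h₁ : Tendsto (χ θ) (𝓝[>] (stopTime χ θ)) (𝓝 (χ θ (stopTime χ θ))) :=
    hc.continuousAt.tendsto.mono_left nhdsWithin_le_nhds
  have h₂ : Tendsto (χ θ) (𝓝[>] (stopTime χ θ)) (𝓝 (χ θ s)) := by
    refine tendsto_const_nhds.congr' ?_
    filter_upwards [Ioo_mem_nhdsGT hs] with u hu
    exact eq_of_stopTime_lt he hu.1 s hu.2.le
  exact tendsto_nhds_unique h₂ h₁

lemma movesAfter_iff_lt_stopTime {χ : ℝ → ℝ → Euc d} {θ t : ℝ} (hc : Continuous (χ θ))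
    (he : ∃ t, 0 < t ∧ ∀ t' ≥ t, χ θ t' = χ θ t) (ht : 0 < t) :
    MovesAfter χ θ t ↔ t < stopTime χ θ := by
  rw [← not_iff_not, not_movesAfter_iff hc, not_lt]
  refine ⟨stopTime_le ht, fun h s hs => ?_⟩
  rw [eq_stopTime hc he s (h.trans hs), eq_stopTime hc he t h]

lemma measurableSet_movesAfter {χ : ℝ → ℝ → Euc d} (h : Measurable (Function.uncurry χ)) :
    MeasurableSet {p : ℝ × ℝ | MovesAfter χ p.1 p.2} := by
  have : {p : ℝ × ℝ | MovesAfter χ p.1 p.2} =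
      ⋃ q : ℚ≥0, {p : ℝ × ℝ | χ p.1 (p.2 + q) = χ p.1 p.2}ᶜ := by
    ext p; simp [MovesAfter]
  rw [this]
  refine MeasurableSet.iUnion fun q => (measurableSet_eq_fun ?_ ?_).compl
  · exact h.comp (measurable_fst.prodMk (measurable_snd.add_const _))
  · exact h

lemma measurableSet_movesAfter_left {χ : ℝ → ℝ → Euc d} (h : Measurable (Function.uncurry χ))
    (t : ℝ) : MeasurableSet {θ | MovesAfter χ θ t} :=
  (measurable_id.prodMk measurable_const) (measurableSet_movesAfter h)

lemma measurableSet_Theta (μ : Measure (Euc d)) : MeasurableSet (Theta μ) := measurableSet_Icc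

lemma volume_Theta_ne_top (μ : Measure (Euc d)) : volume (Theta μ) ≠ ∞ := by
  simp [Theta]

/-- Markov's inequality for the stopping time. -/
lemma volume_movesAfter_le {μ : Measure (Euc d)} {χ : ℝ → ℝ → Euc d} (h : IsIrrigPlan μ χ)
    {A C : ℝ} (hA : 0 < A)
    (hT : ∫⁻ θ in Theta μ, ENNReal.ofReal (stopTime χ θ) ≤ ENNReal.ofReal C) :
    (volume.restrict (Theta μ)) {θ | MovesAfter χ θ A} ≤ ENNReal.ofReal (C / A) := by
  have hS := measurableSet_movesAfter_left h.measurable A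
  rw [ENNReal.ofReal_div_of_pos hA, ENNReal.le_div_iff_mul_le (by simp [hA]) (by simp), mul_comm,
    ← lintegral_indicator_const hS]
  refine le_trans (setLIntegral_mono' (measurableSet_Theta μ) fun θ hθ => ?_) hT
  by_cases hm : MovesAfter χ θ A
  · rw [Set.indicator_of_mem (by exact hm)]
    exact ENNReal.ofReal_le_ofReal ((movesAfter_iff_lt_stopTime (h.lipschitz θ hθ).continuous
      (h.eventuallyConst θ hθ) hA).1 hm).le
  · rw [Set.indicator_of_notMem (by exact hm)]
    exact zero_le

section Kernel

variable {J : ℝ → ℝ}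

/-- The kernel `J(· / ε)`, extended to negative arguments by its value at `0`. -/
def extKernel (J : ℝ → ℝ) (ε r : ℝ) : ℝ≥0∞ := ENNReal.ofReal (J (max r 0 / ε))

lemma MollKernel.antitone_extKernel (hJ : MollKernel J) {ε : ℝ} (hε : 0 < ε) :
    Antitone (extKernel J ε) := fun r s hrs =>
  ENNReal.ofReal_le_ofReal <| hJ.2.1 (Set.mem_Ici.2 (by positivity))
    (Set.mem_Ici.2 (by positivity)) (by gcongr)

lemma MollKernel.continuous_extKernel (hJ : MollKernel J) {ε : ℝ} (hε : 0 < ε) :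
    Continuous (extKernel J ε) := by
  obtain ⟨K, hK⟩ := hJ.2.2.1
  refine ENNReal.continuous_ofReal.comp (hK.continuousOn.comp_continuous (by fun_prop) fun r => ?_)
  exact Set.mem_Ici.2 (by positivity)

lemma MollKernel.extKernel_le_one (hJ : MollKernel J) {ε : ℝ} (hε : 0 < ε) (r : ℝ) :
    extKernel J ε r ≤ 1 := by
  rw [extKernel, ← ENNReal.ofReal_one, ← hJ.2.2.2.1]
  exact ENNReal.ofReal_le_ofReal <| hJ.2.1 Set.self_mem_Ici
    (Set.mem_Ici.2 (by positivity)) (by positivity)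

lemma extKernel_pathInfDist (J : ℝ → ℝ) (ε : ℝ) (χ : ℝ → ℝ → Euc d) (θ : ℝ) (x : Euc d) :
    extKernel J ε (pathInfDist χ θ x) = ENNReal.ofReal (J (pathInfDist χ θ x / ε)) := by
  rw [extKernel, max_eq_left (pathInfDist_nonneg χ θ x)]

lemma Wmol_eq_lintegral_extKernel {μ : Measure (Euc d)} {χ : ℝ → ℝ → Euc d}
    (h : IsIrrigPlan μ χ) (J : ℝ → ℝ) (ε : ℝ) (x : Euc d) :
    Wmol μ J ε χ x = ∫⁻ θ in Theta μ, extKernel J ε (⨅ q : ℚ≥0, dist (χ θ (q : ℝ)) x) := by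
  refine setLIntegral_congr_fun (measurableSet_Theta μ) fun θ hθ => ?_
  simp only [← pathInfDist_eq_iInf_nnrat (h.lipschitz θ hθ), extKernel_pathInfDist]

lemma measurable_extKernel_iInf_dist {χ : ℝ → ℝ → Euc d} (h : Measurable (Function.uncurry χ))
    (hJ : MollKernel J) {ε : ℝ} (hε : 0 < ε) :
    Measurable fun p : ℝ × Euc d => extKernel J ε (⨅ q : ℚ≥0, dist (χ p.1 (q : ℝ)) p.2) := by
  have hinf : Measurable fun p : ℝ × Euc d => ⨅ q : ℚ≥0, dist (χ p.1 (q : ℝ)) p.2 :=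
    Measurable.iInf fun _ =>
      (h.comp (measurable_fst.prodMk measurable_const)).dist measurable_snd
  exact (hJ.continuous_extKernel hε).measurable.comp hinf

lemma measurable_Wmol {μ : Measure (Euc d)} {χ : ℝ → ℝ → Euc d} (h : IsIrrigPlan μ χ)
    (hJ : MollKernel J) {ε : ℝ} (hε : 0 < ε) : Measurable (Wmol μ J ε χ) := by
  rw [show Wmol μ J ε χ = _ from funext (Wmol_eq_lintegral_extKernel h J ε)]
  exact (measurable_extKernel_iInf_dist h.measurable hJ hε).lintegral_prod_left'

end Kernel

section Convergence

variable {μ : Measure (Euc d)} {J : ℝ → ℝ} {ε C : ℝ}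
  {χs : ℕ → ℝ → ℝ → Euc d} {χ : ℝ → ℝ → Euc d}

/-- Along a convergent sequence of paths which stop before time `A`, the infimum distance is
lower semicontinuous. -/
lemma eventually_pathInfDist_ge {θ : ℝ} (hs : ∀ n, LipschitzWith 1 (χs n θ))
    (h : LipschitzWith 1 (χ θ)) (h₀ : ∀ n, χs n θ 0 = χ θ 0)
    (hlim : Tendsto (fun n => dPath (χs n θ) (χ θ)) atTop (𝓝 0)) {A : ℝ} (hA : 0 ≤ A)
    {x : ℕ → Euc d} {x₀ : Euc d} (hx : Tendsto x atTop (𝓝 x₀)) {η : ℝ} (hη : 0 < η) :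
    ∀ᶠ n in atTop, ¬ MovesAfter (χs n) θ A →
      pathInfDist χ θ x₀ - η ≤ pathInfDist (χs n) θ (x n) := by
  filter_upwards [eventually_dist_lt_of_tendsto_dPath hs h h₀ hlim A (half_pos hη),
    Metric.tendsto_nhds.1 hx _ (half_pos hη)] with n hn hxn hm
  rw [not_movesAfter_iff (hs n).continuous] at hm
  have key : ∀ t ∈ Set.Icc 0 A, pathInfDist χ θ x₀ - η ≤ dist (χs n θ t) (x n) := by
    intro t ht
    have h₁ := pathInfDist_le χ θ x₀ ht.1
    have h₂ := hn t ht
    have h₃ := dist_triangle4 (χ θ t) (χs n θ t) (x n) x₀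
    rw [dist_comm (χ θ t) (χs n θ t)] at h₃
    linarith
  refine le_pathInfDist fun t ht => ?_
  rcases le_total t A with htA | htA
  · exact key t ⟨ht, htA⟩
  · rw [hm t htA]
    exact key A ⟨hA, le_rfl⟩

/-- The integrand of the mollified multiplicity, restricted to the particles that are at rest
from time `A` on. -/
def restKernel (J : ℝ → ℝ) (ε A : ℝ) (χ : ℝ → ℝ → Euc d) (x : Euc d) : ℝ → ℝ≥0∞ :=
  {θ | MovesAfter χ θ A}ᶜ.indicator fun θ => extKernel J ε (⨅ q : ℚ≥0, dist (χ θ (q : ℝ)) x)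

lemma measurable_restKernel (h : Measurable (Function.uncurry χ)) (hJ : MollKernel J)
    (hε : 0 < ε) (A : ℝ) (x : Euc d) : Measurable (restKernel J ε A χ x) := by
  have hker := (measurable_extKernel_iInf_dist h hJ hε).comp (measurable_prodMk_right (y := x))
  simp only [Function.comp_def] at hker
  rw [restKernel]
  refine hker.indicator ?_
  exact (measurableSet_movesAfter_left h A).compl

lemma restKernel_le_one (hJ : MollKernel J) (hε : 0 < ε) (A : ℝ) (x : Euc d) (θ : ℝ) :
    restKernel J ε A χ x θ ≤ 1 :=
  (Set.indicator_le_self _ _ θ).trans (hJ.extKernel_le_one hε _)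

lemma Wmol_le_lintegral_restKernel_add (h : IsIrrigPlan μ χ) (hJ : MollKernel J) (hε : 0 < ε)
    {A : ℝ} (hA : 0 < A)
    (hT : ∫⁻ θ in Theta μ, ENNReal.ofReal (stopTime χ θ) ≤ ENNReal.ofReal C) (x : Euc d) :
    Wmol μ J ε χ x ≤
      (∫⁻ θ in Theta μ, restKernel J ε A χ x θ) + ENNReal.ofReal (C / A) := by
  rw [Wmol_eq_lintegral_extKernel h]
  calc ∫⁻ θ in Theta μ, extKernel J ε (⨅ q : ℚ≥0, dist (χ θ (q : ℝ)) x)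
      ≤ ∫⁻ θ in Theta μ,
          (restKernel J ε A χ x θ + {θ | MovesAfter χ θ A}.indicator 1 θ) := by
        refine lintegral_mono fun θ => ?_
        by_cases hθ : MovesAfter χ θ A
        · simpa [restKernel, hθ] using hJ.extKernel_le_one hε _
        · simp [restKernel, hθ]
    _ = (∫⁻ θ in Theta μ, restKernel J ε A χ x θ) +
          (volume.restrict (Theta μ)) {θ | MovesAfter χ θ A} := by
        rw [lintegral_add_left (measurable_restKernel h.measurable hJ hε A x),
          lintegral_indicator_one (measurableSet_movesAfter_left h.measurable A)]
    _ ≤ _ := by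
        gcongr
        exact volume_movesAfter_le h hA hT

lemma limsup_restKernel_le (hJ : MollKernel J) (hε : 0 < ε) {θ : ℝ}
    (hs : ∀ n, LipschitzWith 1 (χs n θ)) (h : LipschitzWith 1 (χ θ))
    (h₀ : ∀ n, χs n θ 0 = χ θ 0)
    (hlim : Tendsto (fun n => dPath (χs n θ) (χ θ)) atTop (𝓝 0)) {A : ℝ} (hA : 0 ≤ A)
    {x : ℕ → Euc d} {x₀ : Euc d} (hx : Tendsto x atTop (𝓝 x₀)) :
    limsup (fun n => restKernel J ε A (χs n) (x n) θ) atTop ≤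
      extKernel J ε (pathInfDist χ θ x₀) := by
  have hη : ∀ η > 0, limsup (fun n => restKernel J ε A (χs n) (x n) θ) atTop ≤
      extKernel J ε (pathInfDist χ θ x₀ - η) := by
    intro η hη
    refine limsup_le_of_le (by isBoundedDefault) ?_
    filter_upwards [eventually_pathInfDist_ge hs h h₀ hlim hA hx hη] with n hn
    by_cases hm : MovesAfter (χs n) θ A
    · simp [restKernel, hm]
    · rw [restKernel, Set.indicator_of_mem (by exact hm), ← pathInfDist_eq_iInf_nnrat (hs n)]
      exact hJ.antitone_extKernel hε (hn hm)
  have hc : Continuous fun η => extKernel J ε (pathInfDist χ θ x₀ - η) :=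
    (hJ.continuous_extKernel hε).comp (continuous_const.sub continuous_id)
  have hlim : Tendsto (fun η => extKernel J ε (pathInfDist χ θ x₀ - η)) (𝓝[>] 0)
      (𝓝 (extKernel J ε (pathInfDist χ θ x₀))) := by
    simpa using (hc.tendsto 0).mono_left nhdsWithin_le_nhds
  exact ge_of_tendsto hlim (eventually_mem_nhdsWithin.mono hη)

/-- Upper semicontinuity of the mollified multiplicity. -/
lemma limsup_Wmol_le (hJ : MollKernel J) (hε : 0 < ε) (hχs : ∀ n, IsIrrigPlan μ (χs n))
    (hχ : IsIrrigPlan μ χ) (hconv : PlansTendsto μ χs χ)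
    (hT : ∀ n, ∫⁻ θ in Theta μ, ENNReal.ofReal (stopTime (χs n) θ) ≤ ENNReal.ofReal C)
    {x : ℕ → Euc d} {x₀ : Euc d} (hx : Tendsto x atTop (𝓝 x₀)) :
    limsup (fun n => Wmol μ J ε (χs n) (x n)) atTop ≤ Wmol μ J ε χ x₀ := by
  have bound : ∀ A : ℝ, 0 < A → limsup (fun n => Wmol μ J ε (χs n) (x n)) atTop ≤
      Wmol μ J ε χ x₀ + ENNReal.ofReal (C / A) := by
    intro A hA
    calc limsup (fun n => Wmol μ J ε (χs n) (x n)) atTop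
        ≤ limsup (fun n => (∫⁻ θ in Theta μ, restKernel J ε A (χs n) (x n) θ) +
            ENNReal.ofReal (C / A)) atTop :=
          limsup_le_limsup (Eventually.of_forall fun n =>
            Wmol_le_lintegral_restKernel_add (hχs n) hJ hε hA (hT n) (x n))
      _ = limsup (fun n => ∫⁻ θ in Theta μ, restKernel J ε A (χs n) (x n) θ) atTop +
            ENNReal.ofReal (C / A) :=
          limsup_add_const _ _ _ (by isBoundedDefault) (by isBoundedDefault)
      _ ≤ (∫⁻ θ in Theta μ, limsup (fun n => restKernel J ε A (χs n) (x n) θ) atTop) +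
            ENNReal.ofReal (C / A) := by
          gcongr
          refine limsup_lintegral_le 1
            (fun n => measurable_restKernel (hχs n).measurable hJ hε A (x n))
            (fun n => Eventually.of_forall (restKernel_le_one hJ hε A (x n))) ?_
          simpa using volume_Theta_ne_top μ
      _ ≤ _ := by
          gcongr
          refine lintegral_mono_ae ?_
          filter_upwards [hconv, ae_restrict_mem (measurableSet_Theta μ)] with θ hθ hmem
          rw [← extKernel_pathInfDist]
          exact limsup_restKernel_le hJ hε (fun n => (hχs n).lipschitz θ hmem)
            (hχ.lipschitz θ hmem)
            (fun n => ((hχs n).init θ hmem).trans (hχ.init θ hmem).symm) hθ hA.le hx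
  have h₀ : Tendsto (fun A : ℝ => ENNReal.ofReal (C / A)) atTop (𝓝 0) := by
    simpa using ENNReal.tendsto_ofReal (tendsto_id.const_div_atTop C)
  have hlim : Tendsto (fun A : ℝ => Wmol μ J ε χ x₀ + ENNReal.ofReal (C / A)) atTop
      (𝓝 (Wmol μ J ε χ x₀)) := by
    simpa using tendsto_const_nhds.add h₀
  exact ge_of_tendsto hlim ((eventually_gt_atTop 0).mono bound)

lemma rpow_Wmol_le_liminf (hJ : MollKernel J) (hε : 0 < ε) (hχs : ∀ n, IsIrrigPlan μ (χs n))
    (hχ : IsIrrigPlan μ χ) (hconv : PlansTendsto μ χs χ)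
    (hT : ∀ n, ∫⁻ θ in Theta μ, ENNReal.ofReal (stopTime (χs n) θ) ≤ ENNReal.ofReal C)
    {x : ℕ → Euc d} {x₀ : Euc d} (hx : Tendsto x atTop (𝓝 x₀)) {s : ℝ} (hs : s ≤ 0) :
    Wmol μ J ε χ x₀ ^ s ≤ liminf (fun n => Wmol μ J ε (χs n) (x n) ^ s) atTop := by
  have hanti : Antitone fun y : ℝ≥0∞ => y ^ s := fun a b hab =>
by
    simpa only [ENNReal.rpow_neg, neg_neg, ENNReal.inv_le_inv] using
      ENNReal.inv_le_inv.2 (ENNReal.rpow_le_rpow hab (neg_nonneg.2 hs))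
  refine (hanti (limsup_Wmol_le hJ hε hχs hχ hconv hT hx)).trans_eq ?_
  exact hanti.map_limsup_of_continuousAt _ ENNReal.continuous_rpow_const.continuousAt

/-- A path which moves after time `t` is the limit of paths which eventually do so. -/
lemma eventually_movesAfter {θ t : ℝ} (hs : ∀ n, LipschitzWith 1 (χs n θ))
    (h : LipschitzWith 1 (χ θ)) (h₀ : ∀ n, χs n θ 0 = χ θ 0)
    (hlim : Tendsto (fun n => dPath (χs n θ) (χ θ)) atTop (𝓝 0)) (ht : 0 ≤ t)
    (hm : MovesAfter χ θ t) : ∀ᶠ n in atTop, MovesAfter (χs n) θ t := by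
  obtain ⟨q, hq⟩ := hm
  have hq' : (0 : ℝ) ≤ t + q := add_nonneg ht q.cast_nonneg
  filter_upwards [((tendsto_of_tendsto_dPath hs h h₀ hlim hq').sub
    (tendsto_of_tendsto_dPath hs h h₀ hlim ht)).eventually_ne (sub_ne_zero.2 hq)] with n hn
  exact ⟨q, sub_ne_zero.1 hn⟩

/-- The integrand of the mollified cost, with the speed replaced by the indicator of the motion. -/
def movingIntegrand (μ : Measure (Euc d)) (J : ℝ → ℝ) (α ε : ℝ) (χ : ℝ → ℝ → Euc d)
    (p : ℝ × ℝ) : ℝ≥0∞ :=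
  {p : ℝ × ℝ | MovesAfter χ p.1 p.2}.indicator
    (fun p => Wmol μ J ε χ (χ p.1 p.2) ^ (α - 1)) p

lemma measurable_movingIntegrand (h : IsIrrigPlan μ χ) (hJ : MollKernel J) (hε : 0 < ε)
    (α : ℝ) : Measurable (movingIntegrand μ J α ε χ) :=
  Measurable.indicator
    (((measurable_Wmol h hJ hε).comp h.measurable).pow_const (α - 1))
    (measurableSet_movesAfter h.measurable)

lemma Emol_eq_of_arcLength (h : IsIrrigPlan μ χ) (harc : ArcLength μ χ) (J : ℝ → ℝ) (α ε : ℝ) :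
    Emol μ J α ε χ =
      ∫⁻ θ in Theta μ, ∫⁻ t in Set.Ici (0 : ℝ), movingIntegrand μ J α ε χ (θ, t) := by
  refine setLIntegral_congr_fun (measurableSet_Theta μ) fun θ hθ => ?_
  refine setLIntegral_congr_fun_ae measurableSet_Ici ?_
  filter_upwards [harc θ hθ, Measure.ae_ne volume 0, Measure.ae_ne volume (stopTime χ θ)]
    with t ht h0 hT hmem
  have hpos : 0 < t := lt_of_le_of_ne hmem (Ne.symm h0)
  have hiff := movesAfter_iff_lt_stopTime (h.lipschitz θ hθ).continuous
    (h.eventuallyConst θ hθ) hpos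
  rcases lt_or_gt_of_ne hT with hlt | hgt
  · have h1 : ‖deriv (χ θ) t‖₊ = 1 := NNReal.eq (ht.1 hpos hlt)
    rw [movingIntegrand, Set.indicator_of_mem (by exact hiff.2 hlt), h1]
    simp
  · have h1 : ‖deriv (χ θ) t‖₊ = 0 := NNReal.eq (ht.2 hgt)
    rw [movingIntegrand, Set.indicator_of_notMem (by exact fun hm => hgt.not_gt (hiff.1 hm)), h1]
    simp

end Convergence

end MollifiedCost

/-- lower semicontinuity of the mollified irrigation cost. -/
theorem mollified_cost_lsc {d : ℕ} (hd : 1 ≤ d)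
    (μ : Measure (Euc d)) [IsFiniteMeasure μ]
    (hsupp : ∃ R : ℝ, μ (Metric.closedBall 0 R)ᶜ = 0)
    (J : ℝ → ℝ) (hJ : MollKernel J) (ε : ℝ) (hε : 0 < ε)
    (α : ℝ) (hα : α ∈ Set.Icc (0:ℝ) 1)
    (χs : ℕ → ℝ → ℝ → Euc d) (χ : ℝ → ℝ → Euc d)
    (hχs : ∀ n, IsIrrigPlan μ (χs n)) (harc : ∀ n, ArcLength μ (χs n))
    (hχ : IsIrrigPlan μ χ)
    (hconv : PlansTendsto μ χs χ)
    (C : ℝ) (hC : 0 < C)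
    (hT : ∀ n, ∫⁻ θ in Theta μ, ENNReal.ofReal (stopTime (χs n) θ) ≤ ENNReal.ofReal C) :
    Emol μ J α ε χ ≤ Filter.liminf (fun n => Emol μ J α ε (χs n)) atTop := by
  have hmeas := fun n => measurable_movingIntegrand (hχs n) hJ hε α
  simp_rw [fun n => Emol_eq_of_arcLength (hχs n) (harc n) J α ε]
  refine le_trans ?_ (lintegral_liminf_le fun n => (hmeas n).lintegral_prod_right')
  refine lintegral_mono_ae ?_
  filter_upwards [hconv, ae_restrict_mem (measurableSet_Theta μ)] with θ hθ hmem
  have hlip := fun n => (hχs n).lipschitz θ hmem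
  have hinit := fun n => ((hχs n).init θ hmem).trans (hχ.init θ hmem).symm
  refine le_trans ?_ (lintegral_liminf_le fun n => (hmeas n).comp measurable_prodMk_left)
  refine lintegral_mono_ae ?_
  filter_upwards [ae_restrict_mem measurableSet_Ici,
    ae_restrict_of_ae (Measure.ae_ne volume 0),
    ae_restrict_of_ae (Measure.ae_ne volume (stopTime χ θ))] with t ht h0 hne
  have hpos : 0 < t := lt_of_le_of_ne ht (Ne.symm h0)
  rcases lt_or_gt_of_ne hne with hlt | hgt
  · have hm := (movesAfter_iff_lt_stopTime (hχ.lipschitz θ hmem).continuous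
      (hχ.eventuallyConst θ hmem) hpos).2 hlt
    have hspeed : (‖deriv (χ θ) t‖₊ : ℝ≥0∞) ≤ 1 := by
      exact_mod_cast norm_deriv_le_of_lipschitz (hχ.lipschitz θ hmem)
    calc Wmol μ J ε χ (χ θ t) ^ (α - 1) * (‖deriv (χ θ) t‖₊ : ℝ≥0∞)
        ≤ Wmol μ J ε χ (χ θ t) ^ (α - 1) := mul_le_of_le_one_right' hspeed
      _ ≤ liminf (fun n => Wmol μ J ε (χs n) (χs n θ t) ^ (α - 1)) atTop :=
        rpow_Wmol_le_liminf hJ hε hχs hχ hconv hT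
          (tendsto_of_tendsto_dPath hlip (hχ.lipschitz θ hmem) hinit hθ ht)
          (by linarith [hα.2])
      _ ≤ _ := by
        refine liminf_le_liminf ?_
        filter_upwards [eventually_movesAfter hlip (hχ.lipschitz θ hmem) hinit hθ ht hm]
          with n hn
        rw [movingIntegrand, Set.indicator_of_mem (by exact hn)]
  · have hconst : χ θ =ᶠ[𝓝 t] fun _ => χ θ (stopTime χ θ) := by
      filter_upwards [Ioi_mem_nhds hgt] with s hs
      exact eq_stopTime (hχ.lipschitz θ hmem).continuous (hχ.eventuallyConst θ hmem) s
        (le_of_lt hs)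
    simp [hconst.deriv_eq]

end
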